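/- Let U : ℝ^d → ℝ be continuously differentiable with e^{−U} integrable, and let μ be the probability measure on ℝ^{2d} with density proportional to e^{−H}, where H(x,v) = |v|²/2 + U(x). Then the MAKLA transition leaves μ invariant: if Z₀ ~ μ and Z' = O_{h/2}(ξ₂)∘θ̂_h(𝒰)∘O_{h/2}(ξ₁)(Z₀) with ξ₁, ξ₂ ~ N(0,I_d) and 𝒰 ~ Unif(0,1) independent of each other and of Z₀, then Z' ~ μ. -/

import Mathlib

open Real MeasureTheory

/-- The standard Gaussian measure `N(0, I_d)` on `ℝ^d`, via its Lebesgue density. -/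
noncomputable def stdGaussian (d : ℕ) : Measure (EuclideanSpace ℝ (Fin d)) :=
  volume.withDensity fun x =>
    ENNReal.ofReal ((2 * Real.pi) ^ (-(d : ℝ) / 2) * Real.exp (-‖x‖ ^ 2 / 2))

/-- The uniform distribution on `(0,1)`. -/
noncomputable def unif01 : Measure ℝ := volume.restrict (Set.Ioo 0 1)

/-- The half Ornstein–Uhlenbeck step `O_{h/2}(b)(x,v) = (x, e^{−γh/2} v + (1−e^{−γh})^{1/2} b)`. -/
noncomputable def OUhalf {d : ℕ} (γ h : ℝ) (b : EuclideanSpace ℝ (Fin d))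
    (z : EuclideanSpace ℝ (Fin d) × EuclideanSpace ℝ (Fin d)) :
    EuclideanSpace ℝ (Fin d) × EuclideanSpace ℝ (Fin d) :=
  (z.1, Real.exp (-(γ * h) / 2) • z.2 + Real.sqrt (1 - Real.exp (-(γ * h))) • b)

/-- The velocity Verlet map `θ_h = θ^{(A)}_{h/2} ∘ θ^{(B)}_h ∘ θ^{(A)}_{h/2}`. -/
noncomputable def verlet {d : ℕ} (U : EuclideanSpace ℝ (Fin d) → ℝ) (h : ℝ)
    (z : EuclideanSpace ℝ (Fin d) × EuclideanSpace ℝ (Fin d)) :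
    EuclideanSpace ℝ (Fin d) × EuclideanSpace ℝ (Fin d) :=
  let z₁ := (z.1 + (h / 2) • z.2, z.2)
  let z₂ := (z₁.1, z₁.2 - h • gradient U z₁.1)
  (z₂.1 + (h / 2) • z₂.2, z₂.2)

/-- The Hamiltonian `H(x,v) = |v|²/2 + U(x)`. -/
noncomputable def Ham {d : ℕ} (U : EuclideanSpace ℝ (Fin d) → ℝ)
    (z : EuclideanSpace ℝ (Fin d) × EuclideanSpace ℝ (Fin d)) : ℝ :=
  ‖z.2‖ ^ 2 / 2 + U z.1

/-- The Metropolis-adjusted Verlet integrator `θ̂_h(u)`: accept `θ_h` if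
`u ≤ exp(−(H∘θ_h − H)⁺)`, otherwise flip the velocity. -/
noncomputable def verletHat {d : ℕ} (U : EuclideanSpace ℝ (Fin d) → ℝ) (h : ℝ) (u : ℝ)
    (z : EuclideanSpace ℝ (Fin d) × EuclideanSpace ℝ (Fin d)) :
    EuclideanSpace ℝ (Fin d) × EuclideanSpace ℝ (Fin d) :=
  if u ≤ Real.exp (-(max 0 (Ham U (verlet U h z) - Ham U z))) then verlet U h z
  else (z.1, -z.2)

/-- One MAKLA transition `O_{h/2}(ξ₂) ∘ θ̂_h(u) ∘ O_{h/2}(ξ₁)`. -/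
noncomputable def maklaStep {d : ℕ} (U : EuclideanSpace ℝ (Fin d) → ℝ) (γ h : ℝ)
    (w : (EuclideanSpace ℝ (Fin d) × EuclideanSpace ℝ (Fin d)) × ℝ)
    (z : EuclideanSpace ℝ (Fin d) × EuclideanSpace ℝ (Fin d)) :
    EuclideanSpace ℝ (Fin d) × EuclideanSpace ℝ (Fin d) :=
  OUhalf γ h w.1.2 (verletHat U h w.2 (OUhalf γ h w.1.1 z))

/-- The Boltzmann–Gibbs probability measure on phase space with density
proportional to `e^{−H}`. -/
noncomputable def gibbs {d : ℕ} (U : EuclideanSpace ℝ (Fin d) → ℝ) :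
    Measure (EuclideanSpace ℝ (Fin d) × EuclideanSpace ℝ (Fin d)) :=
  (∫⁻ z, ENNReal.ofReal (Real.exp (-Ham U z)) ∂volume)⁻¹ •
    volume.withDensity fun z => ENNReal.ofReal (Real.exp (-Ham U z))

section Shear

variable {G : Type*} [AddGroup G] [MeasureSpace G] [MeasurableAdd₂ G]
  [SFinite (volume : Measure G)] [(volume : Measure G).IsAddRightInvariant]

theorem measurePreserving_shear_snd {φ : G → G} (hφ : Measurable φ) :
    MeasurePreserving (fun z : G × G => (z.1, z.2 + φ z.1)) :=
  (MeasurePreserving.id volume).skew_product (g := fun x y => y + φ x)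
    (measurable_snd.add (hφ.comp measurable_fst))
    (ae_of_all _ fun x => (measurePreserving_add_right volume (φ x)).map_eq)

theorem measurePreserving_shear_fst {φ : G → G} (hφ : Measurable φ) :
    MeasurePreserving (fun z : G × G => (z.1 + φ z.2, z.2)) :=
  Measure.measurePreserving_swap.comp
    ((measurePreserving_shear_snd hφ).comp Measure.measurePreserving_swap)

end Shear

/-- A planar rotation acting on pairs of vectors factors into three shears. -/
theorem measurePreserving_rotation {d : ℕ} {a s : ℝ} (hs : s ≠ 0) (has : a ^ 2 + s ^ 2 = 1) :
    MeasurePreserving (fun z : EuclideanSpace ℝ (Fin d) × EuclideanSpace ℝ (Fin d) =>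
      (a • z.1 + s • z.2, a • z.2 - s • z.1)) := by
  have h₁ := measurePreserving_shear_fst (G := EuclideanSpace ℝ (Fin d))
    (φ := fun v => ((1 - a) / s) • v) (by fun_prop)
  have h₂ := measurePreserving_shear_snd (G := EuclideanSpace ℝ (Fin d))
    (φ := fun v => (-s) • v) (by fun_prop)
  convert h₁.comp (h₂.comp h₁) using 1
  funext z
  have e₁ : (1 - a) / s * s = 1 - a := by field_simp
  have e₂ : (1 - a) / s * (1 + a) = s := by
    field_simp
    linarith
  ext i
  · simp only [Function.comp, PiLp.add_apply, PiLp.smul_apply, smul_eq_mul]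
    linear_combination (z.1 i + ((1 - a) / s) * z.2 i) * e₁ - z.2 i * e₂
  · simp only [Function.comp, PiLp.add_apply, PiLp.sub_apply, PiLp.smul_apply, smul_eq_mul]
    linear_combination z.2 i * e₁

theorem norm_sq_rotation {E : Type*} [NormedAddCommGroup E] [InnerProductSpace ℝ E] {a s : ℝ}
    (has : a ^ 2 + s ^ 2 = 1) (v b : E) :
    ‖a • v + s • b‖ ^ 2 + ‖a • b - s • v‖ ^ 2 = ‖v‖ ^ 2 + ‖b‖ ^ 2 := by
  rw [norm_add_sq_real, norm_sub_sq_real]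
  simp only [norm_smul, inner_smul_left, inner_smul_right, mul_pow, Real.norm_eq_abs, sq_abs,
    real_inner_comm v b, RCLike.conj_to_real]
  linear_combination (‖v‖ ^ 2 + ‖b‖ ^ 2) * has

theorem lintegral_stdGaussian_density (d : ℕ) :
    ∫⁻ x : EuclideanSpace ℝ (Fin d),
      ENNReal.ofReal ((2 * Real.pi) ^ (-(d : ℝ) / 2) * Real.exp (-‖x‖ ^ 2 / 2)) = 1 := by
  have hb : (0 : ℝ) < 1 / 2 := by norm_num
  have hI := GaussianFourier.integral_rexp_neg_mul_sq_norm (V := EuclideanSpace ℝ (Fin d)) hb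
  have hexp (x : EuclideanSpace ℝ (Fin d)) : -‖x‖ ^ 2 / 2 = -(1 / 2) * ‖x‖ ^ 2 := by ring
  have hgauss : Integrable fun x : EuclideanSpace ℝ (Fin d) => Real.exp (-(1 / 2) * ‖x‖ ^ 2) := by
    refine Integrable.of_integral_ne_zero ?_
    rw [hI]
    positivity
  simp only [hexp]
  rw [← ofReal_integral_eq_lintegral_ofReal (hgauss.const_mul _)
    (ae_of_all _ fun x => by positivity), integral_const_mul, hI, finrank_euclideanSpace_fin,
    show Real.pi / (1 / 2) = 2 * Real.pi by ring, ← Real.rpow_add (by positivity)]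
  simp [neg_div]

theorem measurable_stdGaussian_density (d : ℕ) :
    Measurable fun x : EuclideanSpace ℝ (Fin d) =>
      ENNReal.ofReal ((2 * Real.pi) ^ (-(d : ℝ) / 2) * Real.exp (-‖x‖ ^ 2 / 2)) := by
  fun_prop

instance (d : ℕ) : IsProbabilityMeasure (stdGaussian d) :=
  ⟨by rw [stdGaussian, withDensity_apply _ MeasurableSet.univ, setLIntegral_univ,
    lintegral_stdGaussian_density]⟩

/-- The rotation of a pair of independent standard Gaussians has a standard Gaussian first
component, here with an unnormalised first Gaussian. -/
theorem lintegral_gaussian_mix {d : ℕ} {a s : ℝ} (hs : s ≠ 0) (has : a ^ 2 + s ^ 2 = 1)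
    {g : EuclideanSpace ℝ (Fin d) → ENNReal} (hg : Measurable g) :
    ∫⁻ v, ENNReal.ofReal (Real.exp (-‖v‖ ^ 2 / 2)) *
        ∫⁻ b, g (a • v + s • b) ∂stdGaussian d =
      ∫⁻ v, ENNReal.ofReal (Real.exp (-‖v‖ ^ 2 / 2)) * g v := by
  set ρ : EuclideanSpace ℝ (Fin d) → ENNReal := fun v => ENNReal.ofReal (Real.exp (-‖v‖ ^ 2 / 2))
  set κ : EuclideanSpace ℝ (Fin d) → ENNReal := fun x =>
    ENNReal.ofReal ((2 * Real.pi) ^ (-(d : ℝ) / 2) * Real.exp (-‖x‖ ^ 2 / 2))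
  have hρ : Measurable ρ := by fun_prop
  have hκ : Measurable κ := measurable_stdGaussian_density d
  have hρκ (v b : EuclideanSpace ℝ (Fin d)) :
      ρ (a • v + s • b) * κ (a • b - s • v) = ρ v * κ b := by
    have h := norm_sq_rotation has v b
    simp only [ρ, κ]
    rw [← ENNReal.ofReal_mul (by positivity), ← ENNReal.ofReal_mul (by positivity),
      mul_left_comm, ← Real.exp_add, mul_left_comm, ← Real.exp_add]
    congr 3
    linear_combination (-1 / 2) * h
  have hF : Measurable fun z : EuclideanSpace ℝ (Fin d) × EuclideanSpace ℝ (Fin d) =>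
      ρ z.1 * κ z.2 * g z.1 := by fun_prop
  calc
    _ = ∫⁻ v, ∫⁻ b, ρ v * κ b * g (a • v + s • b) := by
      refine lintegral_congr fun v => ?_
      rw [stdGaussian, lintegral_withDensity_eq_lintegral_mul _ hκ (by fun_prop),
        ← lintegral_const_mul _ (by fun_prop)]
      exact lintegral_congr fun b => (mul_assoc _ _ _).symm
    _ = ∫⁻ z : EuclideanSpace ℝ (Fin d) × EuclideanSpace ℝ (Fin d),
          ρ z.1 * κ z.2 * g (a • z.1 + s • z.2) :=
      (lintegral_prod (fun z : EuclideanSpace ℝ (Fin d) × EuclideanSpace ℝ (Fin d) =>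
          ρ z.1 * κ z.2 * g (a • z.1 + s • z.2)) (by fun_prop)).symm
    _ = ∫⁻ z : EuclideanSpace ℝ (Fin d) × EuclideanSpace ℝ (Fin d), ρ z.1 * κ z.2 * g z.1 := by
      rw [← (measurePreserving_rotation hs has).lintegral_comp hF]
      simp only [hρκ]
    _ = ∫⁻ v, ∫⁻ b, ρ v * κ b * g v := lintegral_prod _ hF.aemeasurable
    _ = _ := by
      refine lintegral_congr fun v => ?_
      simp only [mul_right_comm (ρ v)]
      rw [lintegral_const_mul _ hκ, lintegral_stdGaussian_density, mul_one]

theorem measurable_Ham {d : ℕ} {U : EuclideanSpace ℝ (Fin d) → ℝ} (hU : Measurable U) :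
    Measurable (Ham U) := by
  unfold Ham
  fun_prop

theorem measurable_OUhalf {d : ℕ} (γ h : ℝ) :
    Measurable fun p : EuclideanSpace ℝ (Fin d) ×
      (EuclideanSpace ℝ (Fin d) × EuclideanSpace ℝ (Fin d)) => OUhalf γ h p.1 p.2 := by
  unfold OUhalf
  fun_prop

/-- The half Ornstein–Uhlenbeck step preserves the unnormalised Gibbs weight. -/
theorem lintegral_OUhalf {d : ℕ} {U : EuclideanSpace ℝ (Fin d) → ℝ} (hU : Measurable U)
    {γ h : ℝ} (hγ : 0 < γ) (hh : 0 < h)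
    {f : EuclideanSpace ℝ (Fin d) × EuclideanSpace ℝ (Fin d) → ENNReal} (hf : Measurable f) :
    ∫⁻ z, ENNReal.ofReal (Real.exp (-Ham U z)) * ∫⁻ b, f (OUhalf γ h b z) ∂stdGaussian d =
      ∫⁻ z, ENNReal.ofReal (Real.exp (-Ham U z)) * f z := by
  have hlt : Real.exp (-(γ * h)) < 1 := Real.exp_lt_one_iff.2 (neg_lt_zero.2 (mul_pos hγ hh))
  have hs : Real.sqrt (1 - Real.exp (-(γ * h))) ≠ 0 := (Real.sqrt_pos.2 (sub_pos.2 hlt)).ne'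
  have has : Real.exp (-(γ * h) / 2) ^ 2 + Real.sqrt (1 - Real.exp (-(γ * h))) ^ 2 = 1 := by
    rw [Real.sq_sqrt (sub_pos.2 hlt).le, ← Real.exp_nat_mul]
    norm_num [mul_div_cancel₀]
  have hH := measurable_Ham hU
  have hinner : Measurable fun z => ∫⁻ b, f (OUhalf γ h b z) ∂stdGaussian d :=
    (hf.comp (measurable_OUhalf γ h)).lintegral_prod_left'
  have hsplit (x v : EuclideanSpace ℝ (Fin d)) : ENNReal.ofReal (Real.exp (-Ham U (x, v))) =
      ENNReal.ofReal (Real.exp (-U x)) * ENNReal.ofReal (Real.exp (-‖v‖ ^ 2 / 2)) := by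
    rw [← ENNReal.ofReal_mul (by positivity), ← Real.exp_add]
    congr 2
    simp only [Ham]
    ring
  rw [Measure.volume_eq_prod, lintegral_prod _ (by fun_prop), lintegral_prod _ (by fun_prop)]
  refine lintegral_congr fun x => ?_
  have hfx : Measurable fun v => f (x, v) := by fun_prop
  simp only [hsplit, mul_assoc]
  rw [lintegral_const_mul' _ _ ENNReal.ofReal_ne_top,
    lintegral_const_mul' _ _ ENNReal.ofReal_ne_top]
  exact congrArg _ (lintegral_gaussian_mix hs has hfx)

theorem measurable_gradient_of_contDiff {E : Type*} [NormedAddCommGroup E] [InnerProductSpace ℝ E]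
    [CompleteSpace E] [MeasurableSpace E] [BorelSpace E] {U : E → ℝ} (hU : ContDiff ℝ 1 U) :
    Measurable (gradient U) :=
  ((InnerProductSpace.toDual ℝ E).symm.continuous.comp
    (hU.continuous_fderiv one_ne_zero)).measurable

theorem measurePreserving_verlet {d : ℕ} {U : EuclideanSpace ℝ (Fin d) → ℝ}
    (hU : Measurable (gradient U)) (h : ℝ) : MeasurePreserving (verlet U h) := by
  have hA := measurePreserving_shear_fst (G := EuclideanSpace ℝ (Fin d))
    (φ := fun v => (h / 2) • v) (by fun_prop)
  have hB := measurePreserving_shear_snd (G := EuclideanSpace ℝ (Fin d))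
    (φ := fun x => -(h • gradient U x)) (by fun_prop)
  convert hA.comp (hB.comp hA) using 1
  funext z
  simp [verlet, sub_eq_add_neg]

/-- Reversing the velocity. -/
def velocityFlip {E : Type*} [Neg E] (z : E × E) : E × E := (z.1, -z.2)

theorem measurePreserving_velocityFlip {d : ℕ} :
    MeasurePreserving (velocityFlip (E := EuclideanSpace ℝ (Fin d))) :=
  (MeasurePreserving.id volume).prod (Measure.measurePreserving_neg volume)

theorem velocityFlip_velocityFlip {E : Type*} [InvolutiveNeg E] (z : E × E) :
    velocityFlip (velocityFlip z) = z := by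
  simp [velocityFlip]

theorem Ham_velocityFlip {d : ℕ} (U : EuclideanSpace ℝ (Fin d) → ℝ)
    (z : EuclideanSpace ℝ (Fin d) × EuclideanSpace ℝ (Fin d)) :
    Ham U (velocityFlip z) = Ham U z := by
  simp [Ham, velocityFlip]

/-- Time reversibility of the Verlet map. -/
theorem verlet_velocityFlip_verlet {d : ℕ} (U : EuclideanSpace ℝ (Fin d) → ℝ) (h : ℝ)
    (z : EuclideanSpace ℝ (Fin d) × EuclideanSpace ℝ (Fin d)) :
    verlet U h (velocityFlip (verlet U h z)) = velocityFlip z := by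
  simp only [verlet, velocityFlip, smul_neg, add_neg_cancel_right, Prod.mk.injEq]
  constructor
  · module
  · abel

theorem lintegral_unif01_ite {α : ℝ} (h₀ : 0 ≤ α) (h₁ : α ≤ 1) (p q : ENNReal) :
    ∫⁻ u, (if u ≤ α then p else q) ∂unif01 =
      ENNReal.ofReal α * p + ENNReal.ofReal (1 - α) * q := by
  have hset : MeasurableSet (Set.Iic α) := measurableSet_Iic
  have hp : unif01 (Set.Iic α) = ENNReal.ofReal α := by
    rw [unif01, Measure.restrict_congr_set Ioo_ae_eq_Ioc, Measure.restrict_apply hset,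
      Set.inter_comm, Set.Ioc_inter_Iic, min_eq_right h₁, Real.volume_Ioc, sub_zero]
  have hq : unif01 (Set.Iic α)ᶜ = ENNReal.ofReal (1 - α) := by
    rw [unif01, Measure.restrict_congr_set Ioo_ae_eq_Ioc, Measure.restrict_apply hset.compl,
      Set.compl_Iic, Set.inter_comm, Set.Ioc_inter_Ioi, max_eq_right h₀, Real.volume_Ioc]
  rw [← lintegral_add_compl _ hset,
    setLIntegral_congr_fun (f := fun u => if u ≤ α then p else q) (g := fun _ => p) hset
      fun u hu => if_pos hu,
    setLIntegral_congr_fun (f := fun u => if u ≤ α then p else q) (g := fun _ => q) hset.compl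
      fun u hu => if_neg hu,
    setLIntegral_const, setLIntegral_const, hp, hq, mul_comm p, mul_comm q]

theorem verletHat_eq {d : ℕ} (U : EuclideanSpace ℝ (Fin d) → ℝ) (h u : ℝ)
    (z : EuclideanSpace ℝ (Fin d) × EuclideanSpace ℝ (Fin d)) :
    verletHat U h u z =
      if u ≤ Real.exp (-(max 0 (Ham U (verlet U h z) - Ham U z))) then verlet U h z
      else velocityFlip z := rfl

/-- The Metropolis-adjusted Verlet step preserves the unnormalised Gibbs weight. -/
theorem lintegral_verletHat {d : ℕ} {U : EuclideanSpace ℝ (Fin d) → ℝ} (hU : ContDiff ℝ 1 U)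
    (h : ℝ) {f : EuclideanSpace ℝ (Fin d) × EuclideanSpace ℝ (Fin d) → ENNReal}
    (hf : Measurable f) :
    ∫⁻ z, ENNReal.ofReal (Real.exp (-Ham U z)) * ∫⁻ u, f (verletHat U h u z) ∂unif01 =
      ∫⁻ z, ENNReal.ofReal (Real.exp (-Ham U z)) * f z := by
  have hθ := measurePreserving_verlet (measurable_gradient_of_contDiff hU) h
  have hφ := measurePreserving_velocityFlip (d := d)
  have hH := measurable_Ham hU.continuous.measurable
  have hθm := hθ.measurable
  have hφm := hφ.measurable
  set w : EuclideanSpace ℝ (Fin d) × EuclideanSpace ℝ (Fin d) → ENNReal :=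
    fun z => ENNReal.ofReal (Real.exp (-Ham U z))
  set α : EuclideanSpace ℝ (Fin d) × EuclideanSpace ℝ (Fin d) → ℝ :=
    fun z => Real.exp (-(max 0 (Ham U (verlet U h z) - Ham U z)))
  have hw : Measurable w := by fun_prop
  have hα : Measurable α := by fun_prop
  have hα₀ z : 0 ≤ α z := (Real.exp_pos _).le
  have hα₁ z : α z ≤ 1 := Real.exp_le_one_iff.2 (neg_nonpos.2 (le_max_left _ _))
  have hwα z : w z * ENNReal.ofReal (α z) =
      ENNReal.ofReal (Real.exp (-max (Ham U z) (Ham U (verlet U h z)))) := by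
    simp only [w, α]
    rw [← ENNReal.ofReal_mul (by positivity), ← Real.exp_add]
    congr 2
    rw [← neg_add, ← max_add_add_left]
    simp
  have hbalance : ∫⁻ z, w z * ENNReal.ofReal (α z) * f (verlet U h z) =
      ∫⁻ z, w z * ENNReal.ofReal (α z) * f (velocityFlip z) := by
    rw [← (hφ.comp hθ).lintegral_comp
      (f := fun z => w z * ENNReal.ofReal (α z) * f (velocityFlip z)) (by fun_prop)]
    refine lintegral_congr fun z => ?_
    simp only [hwα, Function.comp_apply, verlet_velocityFlip_verlet, velocityFlip_velocityFlip,
      Ham_velocityFlip, max_comm]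
  calc
    _ = ∫⁻ z, (w z * ENNReal.ofReal (α z) * f (verlet U h z) +
          w z * ENNReal.ofReal (1 - α z) * f (velocityFlip z)) := by
      refine lintegral_congr fun z => ?_
      simp only [verletHat_eq, apply_ite f]
      rw [lintegral_unif01_ite (hα₀ z) (hα₁ z), mul_add, mul_assoc, mul_assoc]
    _ = ∫⁻ z, (w z * ENNReal.ofReal (α z) * f (velocityFlip z) +
          w z * ENNReal.ofReal (1 - α z) * f (velocityFlip z)) := by
      rw [lintegral_add_left (by fun_prop), hbalance, ← lintegral_add_left (by fun_prop)]
    _ = ∫⁻ z, w (velocityFlip z) * f (velocityFlip z) := by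
      refine lintegral_congr fun z => ?_
      rw [← add_mul, ← mul_add, ← ENNReal.ofReal_add (hα₀ z) (sub_nonneg.2 (hα₁ z))]
      simp [w, Ham_velocityFlip]
    _ = _ := hφ.lintegral_comp (f := fun z => w z * f z) (by fun_prop)

theorem measurable_verletHat {d : ℕ} {U : EuclideanSpace ℝ (Fin d) → ℝ} (hU : ContDiff ℝ 1 U)
    (h : ℝ) : Measurable fun p : ℝ × (EuclideanSpace ℝ (Fin d) × EuclideanSpace ℝ (Fin d)) =>
      verletHat U h p.1 p.2 := by
  have hθm := (measurePreserving_verlet (measurable_gradient_of_contDiff hU) h).measurable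
  have hH := measurable_Ham hU.continuous.measurable
  unfold verletHat
  exact Measurable.ite (measurableSet_le (by fun_prop) (by fun_prop)) (by fun_prop) (by fun_prop)

theorem lintegral_gibbs {d : ℕ} {U : EuclideanSpace ℝ (Fin d) → ℝ} (hU : Measurable U)
    {f : EuclideanSpace ℝ (Fin d) × EuclideanSpace ℝ (Fin d) → ENNReal} (hf : Measurable f) :
    ∫⁻ z, f z ∂gibbs U = (∫⁻ z, ENNReal.ofReal (Real.exp (-Ham U z)))⁻¹ *
      ∫⁻ z, ENNReal.ofReal (Real.exp (-Ham U z)) * f z := by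
  have hH := measurable_Ham hU
  rw [gibbs, lintegral_smul_measure,
    lintegral_withDensity_eq_lintegral_mul _ (by fun_prop) hf]
  rfl

instance : SFinite unif01 := by
  unfold unif01
  infer_instance

/-- The MAKLA transition leaves the measure `μ ∝ e^{−H}` invariant:
if `Z₀ ~ μ` and `ξ₁, ξ₂ ~ N(0,I_d)`, `𝒰 ~ Unif(0,1)` are independent, then
`O_{h/2}(ξ₂) ∘ θ̂_h(𝒰) ∘ O_{h/2}(ξ₁)(Z₀) ~ μ`. -/
theorem makla_invariance (d : ℕ) (U : EuclideanSpace ℝ (Fin d) → ℝ) (γ h : ℝ)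
    (hU : ContDiff ℝ 1 U) (hγ : 0 < γ) (hh : 0 < h)
    (hInt : Integrable (fun x => Real.exp (-U x)) (volume : Measure (EuclideanSpace ℝ (Fin d)))) :
    Measure.map
        (fun p : (EuclideanSpace ℝ (Fin d) × EuclideanSpace ℝ (Fin d)) ×
            ((EuclideanSpace ℝ (Fin d) × EuclideanSpace ℝ (Fin d)) × ℝ) =>
          maklaStep U γ h p.2 p.1)
        ((gibbs U).prod (((stdGaussian d).prod (stdGaussian d)).prod unif01)) =
      gibbs U := by
  have hUm := hU.continuous.measurable
  have hO := measurable_OUhalf (d := d) γ h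
  have hV := measurable_verletHat hU h
  have hstep : Measurable fun p : (EuclideanSpace ℝ (Fin d) × EuclideanSpace ℝ (Fin d)) ×
      ((EuclideanSpace ℝ (Fin d) × EuclideanSpace ℝ (Fin d)) × ℝ) =>
        maklaStep U γ h p.2 p.1 := by
    unfold maklaStep
    fun_prop
  have : SFinite (gibbs U) := by
    unfold gibbs
    infer_instance
  refine Measure.ext_of_lintegral _ fun f hf => ?_
  have hF : Measurable fun z => ∫⁻ b, f (OUhalf γ h b z) ∂stdGaussian d :=
    (hf.comp hO).lintegral_prod_left'
  have hG : Measurable fun z =>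
      ∫⁻ u, ∫⁻ b, f (OUhalf γ h b (verletHat U h u z)) ∂stdGaussian d ∂unif01 :=
    (hF.comp hV).lintegral_prod_left'
  have hK : Measurable fun z => ∫⁻ b₁, ∫⁻ u, ∫⁻ b,
      f (OUhalf γ h b (verletHat U h u (OUhalf γ h b₁ z)))
        ∂stdGaussian d ∂unif01 ∂stdGaussian d :=
    (hG.comp hO).lintegral_prod_left'
  have hnoise (z : EuclideanSpace ℝ (Fin d) × EuclideanSpace ℝ (Fin d)) :
      ∫⁻ w, f (maklaStep U γ h w z) ∂((stdGaussian d).prod (stdGaussian d)).prod unif01 =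
      ∫⁻ b₁, ∫⁻ u, ∫⁻ b, f (OUhalf γ h b (verletHat U h u (OUhalf γ h b₁ z)))
        ∂stdGaussian d ∂unif01 ∂stdGaussian d := by
    have hz : Measurable fun w => f (maklaStep U γ h w z) :=
      hf.comp (hstep.comp measurable_prodMk_left)
    rw [lintegral_prod _ hz.aemeasurable, lintegral_prod _ hz.lintegral_prod_right'.aemeasurable]
    refine lintegral_congr fun b₁ => ?_
    have hb₁ : Measurable fun p : EuclideanSpace ℝ (Fin d) × ℝ =>
        f (maklaStep U γ h ((b₁, p.1), p.2) z) := hz.comp (by fun_prop)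
    exact lintegral_lintegral_swap hb₁.aemeasurable
  rw [lintegral_map hf hstep, lintegral_prod _ (by exact (hf.comp hstep).aemeasurable)]
  simp only [hnoise]
  rw [lintegral_gibbs hUm hK, lintegral_OUhalf hUm hγ hh hG, lintegral_verletHat hU h hF,
    lintegral_OUhalf hUm hγ hh hf, ← lintegral_gibbs hUm hf]
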